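/- arXiv:math/0703094 — 5 statements merged into one kernel-verified Lean document; each statement's English description precedes it below -/
import Mathlib

section
/- Let γ be a symmetric connection field on U (γ(p)(u,v) = γ(p)(v,u) for all p, u, v), let ρ(a,b,c) := ∇_a⁺(∇_b⁺c) − ∇_b⁺(∇_a⁺c) − ∇_{[a,b]}⁺c be its curvature field, and define (∇_d^{+++-}ρ)(a,b,c) := ∇_d⁺(ρ(a,b,c)) − ρ(∇_d⁺a, b, c) − ρ(a, ∇_d⁺b, c) − ρ(a, b, ∇_d⁺c). Then the Bianchi identity (∇_d^{+++-}ρ)(a,b,c) + (∇_a^{+++-}ρ)(b,d,c) + (∇_b^{+++-}ρ)(d,a,c) = 0 holds for all smooth vector fields a, b, c, d on U. -/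
open scoped RealInnerProductSpace

noncomputable section

/-- The model space `ℝⁿ` with its standard inner product. -/
abbrev E (n : ℕ) := EuclideanSpace ℝ (Fin n)

/-- The directional ordinary derivative `a·∂X` of a vector field. -/
def dD {n : ℕ} (a X : E n → E n) (p : E n) : E n := fderiv ℝ X p (a p)

/-- The plus covariant derivative `∇_a⁺X = a·∂X + γ_a(X)` associated to a connection field. -/
def covP {n : ℕ} (γ : E n → E n →L[ℝ] E n →L[ℝ] E n) (a X : E n → E n) (p : E n) : E n :=
  dD a X p + γ p (a p) (X p)

/-- The minus covariant derivative `∇_a⁻X = a·∂X − γ_a†(X)` associated to a connection field. -/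
def covM {n : ℕ} (γ : E n → E n →L[ℝ] E n →L[ℝ] E n) (a X : E n → E n) (p : E n) : E n :=
  dD a X p - ContinuousLinearMap.adjoint (γ p (a p)) (X p)

/-- The Lie bracket `[a,b] = a·∂b − b·∂a` of vector fields. -/
def lie {n : ℕ} (a b : E n → E n) (p : E n) : E n := dD a b p - dD b a p

/-- The curvature field `ρ(a,b,c) = ∇_a⁺(∇_b⁺c) − ∇_b⁺(∇_a⁺c) − ∇_{[a,b]}⁺c`. -/
def rho {n : ℕ} (γ : E n → E n →L[ℝ] E n →L[ℝ] E n) (a b c : E n → E n) : E n → E n :=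
  fun p => covP γ a (covP γ b c) p - covP γ b (covP γ a c) p - covP γ (lie a b) c p

/-- The covariant derivative `(∇_d^{+++-}ρ)(a,b,c)` of the curvature field. -/
def covRho {n : ℕ} (γ : E n → E n →L[ℝ] E n →L[ℝ] E n) (d a b c : E n → E n) : E n → E n :=
  fun p => covP γ d (rho γ a b c) p - rho γ (covP γ d a) b c p
    - rho γ a (covP γ d b) c p - rho γ a b (covP γ d c) p

section Connection

variable {n : ℕ} {U : Set (E n)} {γ : E n → E n →L[ℝ] E n →L[ℝ] E n} {p : E n}

lemma ContDiffOn.differentiableAt_of_isOpen {X : E n → E n} (hX : ContDiffOn ℝ (⊤ : ℕ∞) X U)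
    (hU : IsOpen U) (hp : p ∈ U) : DifferentiableAt ℝ X p :=
  (hX.contDiffAt (hU.mem_nhds hp)).differentiableAt (by simp)

lemma contDiffOn_dD (hU : IsOpen U) {a X : E n → E n} (ha : ContDiffOn ℝ (⊤ : ℕ∞) a U)
    (hX : ContDiffOn ℝ (⊤ : ℕ∞) X U) : ContDiffOn ℝ (⊤ : ℕ∞) (dD a X) U :=
  (hX.fderiv_of_isOpen hU (by simp)).clm_apply ha

lemma contDiffOn_covP (hU : IsOpen U) (hγ : ContDiffOn ℝ (⊤ : ℕ∞) γ U) {a X : E n → E n}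
    (ha : ContDiffOn ℝ (⊤ : ℕ∞) a U) (hX : ContDiffOn ℝ (⊤ : ℕ∞) X U) :
    ContDiffOn ℝ (⊤ : ℕ∞) (covP γ a X) U :=
  (contDiffOn_dD hU ha hX).add ((hγ.clm_apply ha).clm_apply hX)

lemma contDiffOn_lie (hU : IsOpen U) {a b : E n → E n} (ha : ContDiffOn ℝ (⊤ : ℕ∞) a U)
    (hb : ContDiffOn ℝ (⊤ : ℕ∞) b U) : ContDiffOn ℝ (⊤ : ℕ∞) (lie a b) U :=
  (contDiffOn_dD hU ha hb).sub (contDiffOn_dD hU hb ha)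

lemma dD_congr (hU : IsOpen U) (hp : p ∈ U) {a X Y : E n → E n} (h : Set.EqOn X Y U) :
    dD a X p = dD a Y p := by
  have h' : X =ᶠ[nhds p] Y := Filter.eventuallyEq_of_mem (hU.mem_nhds hp) h
  simp only [dD, h'.fderiv_eq]

lemma covP_congr (hU : IsOpen U) (hp : p ∈ U) {a X Y : E n → E n} (h : Set.EqOn X Y U) :
    covP γ a X p = covP γ a Y p := by
  simp only [covP, dD_congr hU hp h, h hp]

lemma dD_sub {a X Y : E n → E n} (hX : DifferentiableAt ℝ X p) (hY : DifferentiableAt ℝ Y p) :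
    dD a (X - Y) p = dD a X p - dD a Y p := by
  simp [dD, fderiv_sub hX hY]

lemma covP_sub {a X Y : E n → E n} (hX : DifferentiableAt ℝ X p)
    (hY : DifferentiableAt ℝ Y p) :
    covP γ a (X - Y) p = covP γ a X p - covP γ a Y p := by
  simp only [covP, dD_sub hX hY, Pi.sub_apply, map_sub]
  abel

lemma covP_sub_left (a b X : E n → E n) :
    covP γ (a - b) X = covP γ a X - covP γ b X := by
  ext1 p
  simp only [covP, dD, Pi.sub_apply, map_sub, sub_apply]
  abel

/-- A symmetric connection is torsion free. -/
lemma covP_sub_covP_eq_lie (hsym : ∀ p ∈ U, ∀ u v : E n, γ p u v = γ p v u)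
    (a b : E n → E n) : Set.EqOn (lie a b) (covP γ a b - covP γ b a) U := by
  intro p hp
  simp only [covP, lie, Pi.sub_apply, hsym p hp (a p) (b p)]
  abel

lemma covP_neg_left (a X : E n → E n) : covP γ (-a) X = -covP γ a X := by
  ext1 p
  simp only [covP, dD, Pi.neg_apply, map_neg, neg_apply]
  abel

lemma lie_swap (a b : E n → E n) : lie a b = -lie b a := by
  ext1 p
  simp [lie]

lemma lie_neg_left (a b : E n → E n) : lie (-a) b = -lie a b := by
  ext1 p
  simp only [lie, dD, fderiv_neg, Pi.neg_apply, map_neg, neg_apply]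
  abel

lemma lie_lie_cyclic_sum_eq_zero (hU : IsOpen U) (hp : p ∈ U) {a b d : E n → E n}
    (ha : ContDiffOn ℝ (⊤ : ℕ∞) a U) (hb : ContDiffOn ℝ (⊤ : ℕ∞) b U)
    (hd : ContDiffOn ℝ (⊤ : ℕ∞) d U) :
    lie (lie a b) d p + lie (lie b d) a p + lie (lie d a) b p = 0 := by
  have key {X : E n → E n} (hX : ContDiffOn ℝ (⊤ : ℕ∞) X U) :
      ContDiffAt ℝ (minSmoothness ℝ 2) X p :=
    (hX.contDiffAt (hU.mem_nhds hp)).of_le (by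
      rw [minSmoothness_of_isRCLikeNormedField]
      exact WithTop.coe_le_coe.2 (le_top : (2 : ℕ∞) ≤ ⊤))
  have h : lie a (lie b d) p = lie (lie a b) d p + lie b (lie a d) p :=
    VectorField.leibniz_identity_lieBracket (n := minSmoothness ℝ 2) le_rfl
      (key ha) (key hb) (key hd)
  rw [lie_swap a (lie b d), lie_swap b (lie a d), lie_swap a d, lie_neg_left] at h
  simp only [Pi.neg_apply, neg_neg] at h
  rw [add_right_comm, ← h, neg_add_cancel]

lemma rho_swap (a b c : E n → E n) : rho γ a b c p = -rho γ b a c p := by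
  simp only [rho, lie_swap a b, covP_neg_left, Pi.neg_apply]
  abel

lemma rho_congr_left (hU : IsOpen U) (hp : p ∈ U) {a a' : E n → E n} (b c : E n → E n)
    (h : Set.EqOn a a' U) : rho γ a b c p = rho γ a' b c p := by
  have h1 : Set.EqOn (covP γ a c) (covP γ a' c) U := fun q hq => by
    simp only [covP, dD, h hq]
  have h2 : lie a b p = lie a' b p := by
    simp only [lie, dD_congr hU hp h]
    simp only [dD, h hp]
  simp only [rho, covP_congr hU hp h1]
  simp only [covP, dD, h hp, h2]

lemma rho_sub_left (hU : IsOpen U) (hγ : ContDiffOn ℝ (⊤ : ℕ∞) γ U) (hp : p ∈ U)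
    {a a' c : E n → E n} (b : E n → E n) (ha : ContDiffOn ℝ (⊤ : ℕ∞) a U)
    (ha' : ContDiffOn ℝ (⊤ : ℕ∞) a' U) (hc : ContDiffOn ℝ (⊤ : ℕ∞) c U) :
    rho γ (a - a') b c p = rho γ a b c p - rho γ a' b c p := by
  have hl : lie (a - a') b p = (lie a b - lie a' b) p := by
    simp only [lie, Pi.sub_apply, dD_sub (ha.differentiableAt_of_isOpen hU hp)
      (ha'.differentiableAt_of_isOpen hU hp)]
    simp only [dD, Pi.sub_apply, map_sub]
    abel
  have hl' : covP γ (lie (a - a') b) c p = covP γ (lie a b) c p - covP γ (lie a' b) c p := by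
    rw [← Pi.sub_apply, ← covP_sub_left]
    simp only [covP, dD, hl]
  simp only [rho, hl', covP_sub_left, Pi.sub_apply,
    covP_sub ((contDiffOn_covP hU hγ ha hc).differentiableAt_of_isOpen hU hp)
      ((contDiffOn_covP hU hγ ha' hc).differentiableAt_of_isOpen hU hp)]
  abel

lemma rho_covP_add_rho_covP (hU : IsOpen U) (hγ : ContDiffOn ℝ (⊤ : ℕ∞) γ U)
    (hsym : ∀ p ∈ U, ∀ u v : E n, γ p u v = γ p v u) (hp : p ∈ U)
    {a c d : E n → E n} (b : E n → E n) (ha : ContDiffOn ℝ (⊤ : ℕ∞) a U)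
    (hc : ContDiffOn ℝ (⊤ : ℕ∞) c U) (hd : ContDiffOn ℝ (⊤ : ℕ∞) d U) :
    rho γ (covP γ d a) b c p + rho γ b (covP γ a d) c p = rho γ (lie d a) b c p := by
  rw [rho_congr_left hU hp b c (covP_sub_covP_eq_lie hsym d a),
    rho_sub_left hU hγ hp b (contDiffOn_covP hU hγ hd ha) (contDiffOn_covP hU hγ ha hd) hc,
    rho_swap b, sub_eq_add_neg]

lemma covP_rho (hU : IsOpen U) (hγ : ContDiffOn ℝ (⊤ : ℕ∞) γ U) (hp : p ∈ U)
    {a b c : E n → E n} (d : E n → E n) (ha : ContDiffOn ℝ (⊤ : ℕ∞) a U)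
    (hb : ContDiffOn ℝ (⊤ : ℕ∞) b U) (hc : ContDiffOn ℝ (⊤ : ℕ∞) c U) :
    covP γ d (rho γ a b c) p = covP γ d (covP γ a (covP γ b c)) p
      - covP γ d (covP γ b (covP γ a c)) p - covP γ d (covP γ (lie a b) c) p := by
  have h1 := (contDiffOn_covP hU hγ ha (contDiffOn_covP hU hγ hb hc)).differentiableAt_of_isOpen
    hU hp
  have h2 := (contDiffOn_covP hU hγ hb (contDiffOn_covP hU hγ ha hc)).differentiableAt_of_isOpen
    hU hp
  have h3 := (contDiffOn_covP hU hγ (contDiffOn_lie hU ha hb) hc).differentiableAt_of_isOpen hU hp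
  rw [← covP_sub h1 h2, ← covP_sub (h1.sub h2) h3]
  rfl

end Connection

/-- Bianchi identity for the curvature field of a symmetric connection field:
`(∇_d^{+++-}ρ)(a,b,c) + (∇_a^{+++-}ρ)(b,d,c) + (∇_b^{+++-}ρ)(d,a,c) = 0`. -/
theorem stmt_2 {n : ℕ} (hn : 1 ≤ n) (U : Set (E n)) (hU : IsOpen U)
    (γ : E n → E n →L[ℝ] E n →L[ℝ] E n) (hγ : ContDiffOn ℝ (⊤ : ℕ∞) γ U)
    (hsym : ∀ p ∈ U, ∀ u v : E n, γ p u v = γ p v u) :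
    ∀ a b c d : E n → E n, ContDiffOn ℝ (⊤ : ℕ∞) a U → ContDiffOn ℝ (⊤ : ℕ∞) b U →
      ContDiffOn ℝ (⊤ : ℕ∞) c U → ContDiffOn ℝ (⊤ : ℕ∞) d U →
      ∀ p ∈ U, covRho γ d a b c p + covRho γ a b d c p + covRho γ b d a c p = 0 := by
  intro a b c d ha hb hc hd p hp
  have hda := rho_covP_add_rho_covP hU hγ hsym hp b ha hc hd
  have hab := rho_covP_add_rho_covP hU hγ hsym hp d hb hc ha
  have hbd := rho_covP_add_rho_covP hU hγ hsym hp a hd hc hb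
  have hJ : covP γ (lie (lie a b) d) c p + covP γ (lie (lie b d) a) c p
      + covP γ (lie (lie d a) b) c p = 0 := by
    have h := lie_lie_cyclic_sum_eq_zero hU hp ha hb hd
    have h' : ∀ v w : E n, fderiv ℝ c p (v + w) + γ p (v + w) (c p)
        = (fderiv ℝ c p v + γ p v (c p)) + (fderiv ℝ c p w + γ p w (c p)) := by
      intro v w
      simp only [map_add, add_apply]
      abel
    simp only [covP, dD]
    rw [← h', ← h', h]
    simp
  simp only [covRho, covP_rho hU hγ hp d ha hb hc, covP_rho hU hγ hp a hb hd hc,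
    covP_rho hU hγ hp b hd ha hc]
  have e : ∀ x y : E n → E n, rho γ x y c p = covP γ x (covP γ y c) p
    - covP γ y (covP γ x c) p - covP γ (lie x y) c p := fun _ _ => rfl
  have e' : ∀ x y z : E n → E n, rho γ x y (covP γ z c) p = covP γ x (covP γ y (covP γ z c)) p
    - covP γ y (covP γ x (covP γ z c)) p - covP γ (lie x y) (covP γ z c) p := fun _ _ _ => rfl
  rw [e (lie _ _)] at hda hab hbd
  rw [e' a b d, e' b d a, e' d a b]
  linear_combination (norm := module) hJ - hda - hab - hbd
end
end

section
/- Let γ be a connection field on U, t : U → End(E) a smooth (1,1)-extensor field, and t† its pointwise adjoint. Define (∇_a^{++}t)(b) := ∇_a⁻(t(b)) − t(∇_a⁺b), (∇_a^{+-}t)(b) := ∇_a⁺(t(b)) − t(∇_a⁺b), and (∇_a^{-+}t)(b) := ∇_a⁻(t(b)) − t(∇_a⁻b). Then for all smooth vector fields a, b, c on U: ⟨(∇_a^{++}t)(b), c⟩ = ⟨b, (∇_a^{++}t†)(c)⟩ and ⟨(∇_a^{+-}t)(b), c⟩ = ⟨b, (∇_a^{-+}t†)(c)⟩; that is, the adjoint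 of ∇_a^{σ₁σ}t equals ∇_a^{σσ₁}(t†), so in particular ∇_a^{++} commutes with the adjoint operation. -/
open scoped RealInnerProductSpace

noncomputable section

/-- The covariant derivative `∇_a^{++}t` of a `(1,1)`-extensor field `t`,
`(∇_a^{++}t)(b) = ∇_a⁻(t(b)) − t(∇_a⁺b)`. -/
def nPP {n : ℕ} (γ : E n → E n →L[ℝ] E n →L[ℝ] E n) (t : E n → E n →L[ℝ] E n)
    (a b : E n → E n) : E n → E n :=
  fun p => covM γ a (fun q => t q (b q)) p - t p (covP γ a b p)

/-- The covariant derivative `∇_a^{+-}t` of a `(1,1)`-extensor field `t`,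
`(∇_a^{+-}t)(b) = ∇_a⁺(t(b)) − t(∇_a⁺b)`. -/
def nPM {n : ℕ} (γ : E n → E n →L[ℝ] E n →L[ℝ] E n) (t : E n → E n →L[ℝ] E n)
    (a b : E n → E n) : E n → E n :=
  fun p => covP γ a (fun q => t q (b q)) p - t p (covP γ a b p)

/-- The covariant derivative `∇_a^{-+}t` of a `(1,1)`-extensor field `t`,
`(∇_a^{-+}t)(b) = ∇_a⁻(t(b)) − t(∇_a⁻b)`. -/
def nMP {n : ℕ} (γ : E n → E n →L[ℝ] E n →L[ℝ] E n) (t : E n → E n →L[ℝ] E n)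
    (a b : E n → E n) : E n → E n :=
  fun p => covM γ a (fun q => t q (b q)) p - t p (covM γ a b p)

/-- The pointwise adjoint `t†` of a `(1,1)`-extensor field. -/
def tadj {n : ℕ} (t : E n → E n →L[ℝ] E n) : E n → E n →L[ℝ] E n :=
  fun p => ContinuousLinearMap.adjoint (t p)

theorem DifferentiableAt.clm_adjoint {F V : Type*} [NormedAddCommGroup F] [NormedSpace ℝ F]
    [NormedAddCommGroup V] [InnerProductSpace ℝ V] [CompleteSpace V]
    {t : F → V →L[ℝ] V} {p : F} (ht : DifferentiableAt ℝ t p) :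
    DifferentiableAt ℝ (fun q => ContinuousLinearMap.adjoint (t q)) p := by
  have hL : IsBoundedLinearMap ℝ
      (fun T : V →L[ℝ] V => ContinuousLinearMap.adjoint T) :=
    { map_add := fun S T => map_add _ S T
      map_smul := fun r T => by simp
      bound := ⟨1, one_pos, fun T => by simp⟩ }
  exact hL.differentiableAt.comp p ht

/-- The adjoint of the directional derivative of `t` is the directional derivative of `t†`, in
the form `⟨a·∂(t(b)) − t(a·∂b), c⟩ = ⟨b, a·∂(t†(c)) − t†(a·∂c)⟩`. -/
theorem inner_dD_sub_eq_inner_dD_tadj_sub {n : ℕ} {t : E n → E n →L[ℝ] E n}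
    {a b c : E n → E n} {p : E n} (ht : DifferentiableAt ℝ t p)
    (hb : DifferentiableAt ℝ b p) (hc : DifferentiableAt ℝ c p) :
    ⟪dD a (fun q => t q (b q)) p - t p (dD a b p), c p⟫ =
      ⟪b p, dD a (fun q => tadj t q (c q)) p - tadj t p (dD a c p)⟫ := by
  have htb : DifferentiableAt ℝ (fun q => t q (b q)) p := ht.clm_apply hb
  have htc : DifferentiableAt ℝ (fun q => tadj t q (c q)) p := ht.clm_adjoint.clm_apply hc
  have hfun : (fun q => ⟪t q (b q), c q⟫) = fun q => ⟪b q, tadj t q (c q)⟫ := by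
    funext q
    exact (ContinuousLinearMap.adjoint_inner_right (t q) (b q) (c q)).symm
  have hderiv := congrArg (fun f => fderiv ℝ f p (a p)) hfun
  simp only [fderiv_inner_apply ℝ htb hc, fderiv_inner_apply ℝ hb htc] at hderiv
  simp only [dD, inner_sub_left, inner_sub_right]
  simp only [tadj, ContinuousLinearMap.adjoint_inner_right] at hderiv ⊢
  linarith

/-- The adjoint of `∇_a^{σ₁σ}t` equals `∇_a^{σσ₁}(t†)`:
`⟨(∇_a^{++}t)(b), c⟩ = ⟨b, (∇_a^{++}t†)(c)⟩` and `⟨(∇_a^{+-}t)(b), c⟩ = ⟨b, (∇_a^{-+}t†)(c)⟩`. -/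
theorem stmt_4 {n : ℕ} (hn : 1 ≤ n) (U : Set (E n)) (hU : IsOpen U)
    (γ : E n → E n →L[ℝ] E n →L[ℝ] E n) (hγ : ContDiffOn ℝ (⊤ : ℕ∞) γ U)
    (t : E n → E n →L[ℝ] E n) (ht : ContDiffOn ℝ (⊤ : ℕ∞) t U) :
    ∀ a b c : E n → E n, ContDiffOn ℝ (⊤ : ℕ∞) a U → ContDiffOn ℝ (⊤ : ℕ∞) b U → ContDiffOn ℝ (⊤ : ℕ∞) c U →
      ∀ p ∈ U,
        ⟪nPP γ t a b p, c p⟫ = ⟪b p, nPP γ (tadj t) a c p⟫ ∧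
        ⟪nPM γ t a b p, c p⟫ = ⟪b p, nMP γ (tadj t) a c p⟫ := by
  intro a b c _ hb hc p hp
  have hpU : U ∈ nhds p := hU.mem_nhds hp
  have hkey := inner_dD_sub_eq_inner_dD_tadj_sub (a := a)
    ((ht.contDiffAt hpU).differentiableAt (by simp))
    ((hb.contDiffAt hpU).differentiableAt (by simp))
    ((hc.contDiffAt hpU).differentiableAt (by simp))
  simp only [inner_sub_left, inner_sub_right] at hkey
  simp only [nPP, nPM, nMP, covP, covM, map_add, map_sub, inner_add_left, inner_add_right,
    inner_sub_left, inner_sub_right]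
  simp only [tadj, ContinuousLinearMap.adjoint_inner_left,
    ContinuousLinearMap.adjoint_inner_right] at hkey ⊢
  constructor <;> linarith
end
end

section
/- (Decomposition of the Christoffel operator.) For every metric field g on U and all smooth vector fields a, b, c on U, the Christoffel operator of the first kind admits the pointwise decomposition [a,b,c] = ⟨g(a·∂b), c⟩ + ½⟨(a·∂g)(b), c⟩ + ½⟨a, (b·∂g)(c) − (c·∂g)(b)⟩, where g(a·∂b) denotes p ↦ g(p)((a·∂b)(p)) and (a·∂g)(b) denotes p ↦ Dg(p)(a(p))(b(p)). (This is the paper's Proposition: [a,b,c] = (a·∂b + ½g⁻¹∘(a·∂g)(b) + ω₀(a)×_g b)·_g c, with the last term being the g-skew-symmetric part determined by the explicit bivector field ω₀.) -/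
open scoped RealInnerProductSpace

noncomputable section

/-- The metric scalar product `b·_g c` of vector fields. -/
def mdot {n : ℕ} (g : E n → E n →L[ℝ] E n) (b c : E n → E n) : E n → ℝ :=
  fun p => ⟪g p (b p), c p⟫

/-- The Christoffel operator of the first kind associated to a metric field `g`. -/
def chr {n : ℕ} (g : E n → E n →L[ℝ] E n) (a b c : E n → E n) (p : E n) : ℝ :=
  (1 / 2) * (fderiv ℝ (mdot g b c) p (a p) + fderiv ℝ (mdot g c a) p (b p)
    - fderiv ℝ (mdot g a b) p (c p)
    + mdot g c (lie a b) p + mdot g b (lie c a) p - mdot g a (lie b c) p)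

/-- Product rule for the metric scalar product of vector fields. -/
theorem fderiv_mdot_apply {n : ℕ} {g : E n → E n →L[ℝ] E n} {b c : E n → E n} {p : E n}
    (hg : DifferentiableAt ℝ g p) (hb : DifferentiableAt ℝ b p) (hc : DifferentiableAt ℝ c p)
    (v : E n) :
    fderiv ℝ (mdot g b c) p v
      = ⟪fderiv ℝ g p v (b p), c p⟫ + ⟪g p (fderiv ℝ b p v), c p⟫
        + ⟪g p (b p), fderiv ℝ c p v⟫ := by
  have h := (hg.hasFDerivAt.clm_apply hb.hasFDerivAt).inner ℝ hc.hasFDerivAt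
  have h' : fderiv ℝ (mdot g b c) p = _ := h.fderiv
  rw [h']
  simp [inner_add_left]
  ring

/-- The derivative of a field of operators that is self-adjoint near `p` is symmetric. -/
theorem inner_fderiv_apply_comm {n : ℕ} {g : E n → E n →L[ℝ] E n} {p : E n}
    (hg : DifferentiableAt ℝ g p)
    (hsa : ∀ᶠ q in nhds p, ContinuousLinearMap.adjoint (g q) = g q) (v x y : E n) :
    ⟪fderiv ℝ g p v x, y⟫ = ⟪fderiv ℝ g p v y, x⟫ := by
  have hconst (z : E n) : DifferentiableAt ℝ (fun _ : E n => z) p := differentiableAt_const z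
  have hxy := fderiv_mdot_apply hg (hconst x) (hconst y) v
  have hyx := fderiv_mdot_apply hg (hconst y) (hconst x) v
  have heq : mdot g (fun _ => x) (fun _ => y) =ᶠ[nhds p] mdot g (fun _ => y) (fun _ => x) := by
    filter_upwards [hsa] with q hq
    simp only [mdot]
    rw [real_inner_comm, ← ContinuousLinearMap.adjoint_inner_left, hq]
  rw [heq.fderiv_eq, hyx] at hxy
  simpa using hxy.symm

/-- Decomposition of the Christoffel operator of the first kind:
`[a,b,c] = ⟨g(a·∂b), c⟩ + ½⟨(a·∂g)(b), c⟩ + ½⟨a, (b·∂g)(c) − (c·∂g)(b)⟩`. -/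
theorem stmt_8 {n : ℕ} (hn : 1 ≤ n) (U : Set (E n)) (hU : IsOpen U)
    (g : E n → E n →L[ℝ] E n) (hg : ContDiffOn ℝ (⊤ : ℕ∞) g U)
    (hgsa : ∀ p ∈ U, ContinuousLinearMap.adjoint (g p) = g p)
    (hgu : ∀ p ∈ U, IsUnit (g p)) :
    ∀ a b c : E n → E n, ContDiffOn ℝ (⊤ : ℕ∞) a U → ContDiffOn ℝ (⊤ : ℕ∞) b U → ContDiffOn ℝ (⊤ : ℕ∞) c U →
      ∀ p ∈ U,
        chr g a b c p
          = ⟪g p (dD a b p), c p⟫ + (1 / 2) * ⟪fderiv ℝ g p (a p) (b p), c p⟫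
            + (1 / 2) * ⟪a p, fderiv ℝ g p (b p) (c p) - fderiv ℝ g p (c p) (b p)⟫ := by
  intro a b c ha hb hc p hp
  have hU' : U ∈ nhds p := hU.mem_nhds hp
  have hg' : DifferentiableAt ℝ g p := (hg.contDiffAt hU').differentiableAt (by simp)
  have ha' : DifferentiableAt ℝ a p := (ha.contDiffAt hU').differentiableAt (by simp)
  have hb' : DifferentiableAt ℝ b p := (hb.contDiffAt hU').differentiableAt (by simp)
  have hc' : DifferentiableAt ℝ c p := (hc.contDiffAt hU').differentiableAt (by simp)
  have hsymm (x y : E n) : ⟪g p x, y⟫ = ⟪g p y, x⟫ := by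
    rw [real_inner_comm, ← ContinuousLinearMap.adjoint_inner_left, hgsa p hp]
  have hD := inner_fderiv_apply_comm hg' (Filter.eventually_of_mem hU' hgsa) (c p) (a p) (b p)
  rw [chr, fderiv_mdot_apply hg' hb' hc', fderiv_mdot_apply hg' hc' ha',
    fderiv_mdot_apply hg' ha' hb', hD]
  simp only [mdot, lie, dD, inner_sub_right]
  rw [hsymm (fderiv ℝ b p (a p)), hsymm (fderiv ℝ c p (b p)), hsymm (fderiv ℝ a p (c p)),
    real_inner_comm (fderiv ℝ g p (b p) (c p)) (a p),
    real_inner_comm (fderiv ℝ g p (c p) (b p)) (a p)]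
  ring
end
end

section
/- Let γ be a connection field and g a metric field on U. Then γ is compatible with g — meaning that for every p ∈ U and every u ∈ E one has g(p)∘γ_{u,p} + γ_{u,p}†∘g(p) = Dg(p)(u), where γ_{u,p} := γ(p)(u, ·) ∈ End(E) and † is the ⟨·,·⟩-adjoint — if and only if the associated pair of covariant derivatives is metric compatible, i.e., ∇_a⁻(g(b)) = g(∇_a⁺b) for all smooth vector fields a, b on U (equivalently ∇_a^{++}g = 0 for all a). -/
open scoped RealInnerProductSpace

noncomputable section

/-- The directional derivative of `g(b)` obeys the product rule. -/
theorem dD_metric_apply {n : ℕ} {g : E n → E n →L[ℝ] E n} {b : E n → E n} {p : E n}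
    (hg : DifferentiableAt ℝ g p) (hb : DifferentiableAt ℝ b p) (a : E n → E n) :
    dD a (fun q => g q (b q)) p = fderiv ℝ g p (a p) (b p) + g p (dD a b p) := by
  simp [dD, fderiv_clm_apply hg hb, add_comm]

/-- A connection field `γ` is compatible with a metric field `g`
(`g∘γ_u + γ_u†∘g = Dg(u)` pointwise) if and only if the associated pair of covariant
derivatives is metric compatible (`∇_a⁻(g(b)) = g(∇_a⁺b)` for all smooth `a`, `b`). -/
theorem stmt_12 {n : ℕ} (hn : 1 ≤ n) (U : Set (E n)) (hU : IsOpen U)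
    (γ : E n → E n →L[ℝ] E n →L[ℝ] E n) (hγ : ContDiffOn ℝ (⊤ : ℕ∞) γ U)
    (g : E n → E n →L[ℝ] E n) (hg : ContDiffOn ℝ (⊤ : ℕ∞) g U)
    (hgsa : ∀ p ∈ U, ContinuousLinearMap.adjoint (g p) = g p)
    (hgu : ∀ p ∈ U, IsUnit (g p)) :
    (∀ p ∈ U, ∀ u : E n,
        (g p).comp (γ p u) + (ContinuousLinearMap.adjoint (γ p u)).comp (g p)
          = fderiv ℝ g p u) ↔
    (∀ a b : E n → E n, ContDiffOn ℝ (⊤ : ℕ∞) a U → ContDiffOn ℝ (⊤ : ℕ∞) b U →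
      ∀ p ∈ U, covM γ a (fun q => g q (b q)) p = g p (covP γ a b p)) := by
  have diff {F : Type} [NormedAddCommGroup F] [NormedSpace ℝ F] {f : E n → F}
      (hf : ContDiffOn ℝ (⊤ : ℕ∞) f U) {p : E n} (hp : p ∈ U) : DifferentiableAt ℝ f p :=
    (hf.contDiffAt (hU.mem_nhds hp)).differentiableAt (by simp)
  constructor
  · intro h a b _ hb p hp
    have key := congrArg (fun L => L (b p)) (h p hp (a p))
    simp only [add_apply, ContinuousLinearMap.comp_apply] at key
    rw [covM, covP, dD_metric_apply (diff hg hp) (diff hb hp), ← key, map_add]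
    abel
  · intro h p hp u
    ext1 v
    have key := h (fun _ => u) (fun _ => v) contDiffOn_const contDiffOn_const p hp
    rw [covM, covP, dD_metric_apply (diff hg hp) (differentiableAt_const v), map_add,
      sub_eq_iff_eq_add, add_comm, add_assoc, add_right_inj] at key
    exact key.symm
end
end

section
/- (First Cartan structure equation.) Let γ be a connection field on U and define the Cartan torsion extensor field Θ(c)(p) := ½ Σ_{μ,ν=1}^n ⟨γ(p)(e_μ, e_ν) − γ(p)(e_ν, e_μ), c(p)⟩ ι(e_μ)∧ι(e_ν) ∈ ⋀E for a smooth vector field c and p ∈ U. Then for every smooth vector field c and every p ∈ U: Θ(c)(p) = Σ_{μ=1}^n ι(e_μ)∧ι(Dc(p)(e_μ)) + Σ_{μ=1}^n ι(e_μ)∧ι(γ⁻(e_μ, c)(p)), where γ⁻(u, c)(p) := Σ_{ν=1}^n ⟨u, (∇_{e_ν}⁻c)(p)⟩ e_ν is the Cartan connection operator of the second kind (the e_ν regarded as constant vector fields). -/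
open scoped RealInnerProductSpace

noncomputable section

/-- The standard orthonormal basis vectors of `ℝⁿ`. -/
def eb {n : ℕ} (μ : Fin n) : E n := EuclideanSpace.single μ (1 : ℝ)

/-- The Cartan torsion extensor field
`Θ(c)(p) = ½ Σ_{μ,ν} ⟨γ(p)(e_μ,e_ν) − γ(p)(e_ν,e_μ), c(p)⟩ ι(e_μ)∧ι(e_ν)`. -/
def cartanTorsion {n : ℕ} (γ : E n → E n →L[ℝ] E n →L[ℝ] E n) (c : E n → E n) (p : E n) :
    ExteriorAlgebra ℝ (E n) :=
  (1 / 2 : ℝ) • ∑ μ : Fin n, ∑ ν : Fin n,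
    ⟪γ p (eb μ) (eb ν) - γ p (eb ν) (eb μ), c p⟫ •
      (ExteriorAlgebra.ι ℝ (eb μ) * ExteriorAlgebra.ι ℝ (eb ν))

/-- The Cartan connection operator of the second kind
`γ⁻(u, c)(p) = Σ_ν ⟨u, (∇_{e_ν}⁻c)(p)⟩ e_ν`. -/
def cartanMinus {n : ℕ} (γ : E n → E n →L[ℝ] E n →L[ℝ] E n) (u : E n) (c : E n → E n)
    (p : E n) : E n :=
  ∑ ν : Fin n, ⟪u, covM γ (fun _ => eb ν) c p⟫ • eb ν

theorem inner_eb_left {n : ℕ} (x : E n) (μ : Fin n) : ⟪eb μ, x⟫ = x μ := by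
  simp [eb, EuclideanSpace.inner_single_left]

theorem sum_smul_eb {n : ℕ} (x : E n) : ∑ ν : Fin n, x ν • eb ν = x := by
  ext i
  simp [eb, Pi.single_apply]

theorem ι_mul_ι_swap {R M : Type*} [CommRing R] [AddCommGroup M] [Module R M] (x y : M) :
    ExteriorAlgebra.ι R x * ExteriorAlgebra.ι R y
      = -(ExteriorAlgebra.ι R y * ExteriorAlgebra.ι R x) :=
  eq_neg_of_add_eq_zero_left (ExteriorAlgebra.ι_add_mul_swap x y)

/-- Transposing the coefficients of a bivector changes its sign. -/
theorem sum_smul_ι_mul_ι_transpose {R M κ : Type*} [CommRing R] [AddCommGroup M] [Module R M]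
    [Fintype κ] (v : κ → M) (f : κ → κ → R) :
    ∑ i, ∑ j, f j i • (ExteriorAlgebra.ι R (v i) * ExteriorAlgebra.ι R (v j))
      = -∑ i, ∑ j, f i j • (ExteriorAlgebra.ι R (v i) * ExteriorAlgebra.ι R (v j)) := by
  rw [Finset.sum_comm, ← Finset.sum_neg_distrib]
  refine Finset.sum_congr rfl fun i _ => ?_
  rw [← Finset.sum_neg_distrib]
  refine Finset.sum_congr rfl fun j _ => ?_
  rw [ι_mul_ι_swap (v j), smul_neg]

theorem inner_eb_covM {n : ℕ} (γ : E n → E n →L[ℝ] E n →L[ℝ] E n) (c : E n → E n) (p : E n)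
    (μ ν : Fin n) :
    ⟪eb μ, covM γ (fun _ => eb ν) c p⟫
      = fderiv ℝ c p (eb ν) μ - ⟪γ p (eb ν) (eb μ), c p⟫ := by
  rw [covM, dD, inner_sub_right, ContinuousLinearMap.adjoint_inner_right, inner_eb_left]

/-- **First Cartan structure equation.**
`Θ(c) = ∂∧c + ∂_s∧γ⁻(s,c)` expressed in the standard orthonormal frame. -/
theorem stmt_17 {n : ℕ} (hn : 1 ≤ n) (U : Set (E n)) (hU : IsOpen U)
    (γ : E n → E n →L[ℝ] E n →L[ℝ] E n) (hγ : ContDiffOn ℝ (⊤ : ℕ∞) γ U) :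
    ∀ c : E n → E n, ContDiffOn ℝ (⊤ : ℕ∞) c U → ∀ p ∈ U,
      cartanTorsion γ c p
        = (∑ μ : Fin n, ExteriorAlgebra.ι ℝ (eb μ) * ExteriorAlgebra.ι ℝ (fderiv ℝ c p (eb μ)))
          + ∑ μ : Fin n,
              ExteriorAlgebra.ι ℝ (eb μ) * ExteriorAlgebra.ι ℝ (cartanMinus γ (eb μ) c p) := by
  intro c _ p _
  have hι : ∀ (μ : Fin n) (f : Fin n → ℝ),
      ExteriorAlgebra.ι ℝ (eb μ) * ExteriorAlgebra.ι ℝ (∑ ν, f ν • eb ν)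
        = ∑ ν, f ν • (ExteriorAlgebra.ι ℝ (eb μ) * ExteriorAlgebra.ι ℝ (eb ν)) := fun μ f => by
    simp only [map_sum, map_smul, Finset.mul_sum, mul_smul_comm]
  have hD : ∀ μ : Fin n,
      ExteriorAlgebra.ι ℝ (eb μ) * ExteriorAlgebra.ι ℝ (fderiv ℝ c p (eb μ))
        = ∑ ν : Fin n, fderiv ℝ c p (eb μ) ν •
            (ExteriorAlgebra.ι ℝ (eb μ) * ExteriorAlgebra.ι ℝ (eb ν)) := fun μ => by
    rw [← hι, sum_smul_eb]
  have hD' := sum_smul_ι_mul_ι_transpose (eb (n := n)) fun μ ν => fderiv ℝ c p (eb μ) ν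
  have hG := sum_smul_ι_mul_ι_transpose (eb (n := n)) fun μ ν => ⟪γ p (eb μ) (eb ν), c p⟫
  simp only [cartanTorsion, cartanMinus, hD, hι]
  simp only [inner_eb_covM, inner_sub_left, sub_smul, Finset.sum_sub_distrib, hD', hG]
  module
end
end
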